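/- arXiv:2212.11163 — 2 statements merged into one kernel-verified Lean document; each statement's English description precedes it below -/
import Mathlib

section
/- Let (M, 𝒯) be a topological space and 𝓕 a set of 𝒯-continuous functions M → ℝ that is closed under smooth operations: for every k ∈ ℕ, every C^∞ function g : ℝᵏ → ℝ, and every f₁, …, f_k ∈ 𝓕, the function x ↦ g(f₁(x), …, f_k(x)) belongs to 𝓕. Then 𝒯 is the smallest topology on M making every function in 𝓕 continuous (i.e. 𝒯 equals the topology on M induced by the family 𝓕 from the standard topology on ℝ) if and only if 𝒯 is 𝓕-regular: for every 𝒯-closed set C ⊆ M and every point x ∈ M \ C there exists ρ ∈ 𝓕 taking values in [0,1] such that the closure of the support of ρ is disjoint from C and ρ is identically 1 on some neighborhood of x. -/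
open scoped Topology

/-- Lemma A.3 (lem:bump): for a topological space `(M, 𝒯)` and a family `𝓕` of continuous
real-valued functions on `M` closed under smooth operations, the topology `𝒯` is the smallest
topology making every function in `𝓕` continuous if and only if `𝒯` is `𝓕`-regular, i.e.
bump functions exist in `𝓕`. -/
theorem smallest_topology_iff_bump_functions {M : Type*} [t : TopologicalSpace M]
    (F : Set (M → ℝ))
    (hcont : ∀ f ∈ F, Continuous f)
    (hsmooth_ops : ∀ (k : ℕ) (g : (Fin k → ℝ) → ℝ), ContDiff ℝ (⊤ : ℕ∞) g →
      ∀ f : Fin k → (M → ℝ), (∀ i, f i ∈ F) →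
        (fun x => g (fun i => f i x)) ∈ F) :
    (t = ⨅ f ∈ F, TopologicalSpace.induced f inferInstance) ↔
      (∀ C : Set M, IsClosed C → ∀ x ∈ Cᶜ, ∃ ρ ∈ F,
        (∀ y, ρ y ∈ Set.Icc (0 : ℝ) 1) ∧
        closure (Function.support ρ) ∩ C = ∅ ∧
        ∀ᶠ y in 𝓝 x, ρ y = 1) := by
  classical
  have key : ∀ x, @nhds M (⨅ f ∈ F, TopologicalSpace.induced f inferInstance) x
      = ⨅ f ∈ F, Filter.comap f (𝓝 (f x)) := by
    intro x
    simp only [nhds_iInf, nhds_induced]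
  constructor
  · intro ht C hC x hx
    let L : Filter M :=
      { sets := {U | ∃ ρ ∈ F, (∀ y, ρ y ∈ Set.Icc (0 : ℝ) 1) ∧
          closure (Function.support ρ) ⊆ U ∧ ∀ᶠ y in 𝓝 x, ρ y = 1}
        univ_sets := by
          refine ⟨fun _ => 1, ?_, fun y => by simp, Set.subset_univ _, by simp⟩
          exact hsmooth_ops 0 (fun _ => 1) contDiff_const (fun i => i.elim0) (fun i => i.elim0)
        sets_of_superset := by
          rintro U V ⟨ρ, h1, h2, h3, h4⟩ hUV
          exact ⟨ρ, h1, h2, h3.trans hUV, h4⟩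
        inter_sets := by
          rintro U V ⟨ρ, h1, h2, h3, h4⟩ ⟨σ, k1, k2, k3, k4⟩
          refine ⟨fun y => ρ y * σ y, ?_, ?_, ?_, ?_⟩
          · have := hsmooth_ops 2 (fun v => v 0 * v 1) (by fun_prop) ![ρ, σ]
              (by intro i; fin_cases i <;> simpa)
            simpa using this
          · intro y
            exact ⟨mul_nonneg (h2 y).1 (k2 y).1, mul_le_one₀ (h2 y).2 (k2 y).1 (k2 y).2⟩
          · refine Set.subset_inter ((closure_mono ?_).trans h3) ((closure_mono ?_).trans k3)
            · intro y hy
              exact left_ne_zero_of_mul hy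
            · intro y hy
              exact right_ne_zero_of_mul hy
          · filter_upwards [h4, k4] with y a b
            rw [a, b, one_mul] }
    have hL : L ≤ 𝓝 x := by
      have e : 𝓝 x = ⨅ f ∈ F, Filter.comap f (𝓝 (f x)) :=
        (congrArg (fun s => @nhds M s x) ht).trans (key x)
      rw [e]
      refine le_iInf₂ fun f hf => ?_
      rintro V ⟨W, hW, hV⟩
      obtain ⟨ε, hε, hb⟩ := Metric.mem_nhds_iff.1 hW
      have hfc := hcont f hf
      refine ⟨fun y => Real.smoothTransition (2 - 4 * ((f y - f x) / ε) ^ 2), ?_, ?_, ?_, ?_⟩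
      · exact hsmooth_ops 1
          (fun v => Real.smoothTransition (2 - 4 * ((v 0 - f x) / ε) ^ 2))
          (Real.smoothTransition.contDiff.comp (by fun_prop)) (fun _ => f) (fun _ => hf)
      · intro y
        exact ⟨Real.smoothTransition.nonneg _, Real.smoothTransition.le_one _⟩
      · have hcl : IsClosed {y | 0 ≤ 2 - 4 * ((f y - f x) / ε) ^ 2} :=
          isClosed_le continuous_const (by fun_prop)
        refine (closure_minimal ?_ hcl).trans ?_
        · intro y hy
          by_contra hn
          exact hy (Real.smoothTransition.zero_of_nonpos (not_le.1 hn).le)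
        · intro y hy
          apply hV
          apply hb
          have hy' : 0 ≤ 2 - 4 * ((f y - f x) / ε) ^ 2 := hy
          have h1 : |(f y - f x) / ε| < 1 := by
            rw [← sq_lt_one_iff_abs_lt_one]
            linarith
          rw [abs_div, abs_of_pos hε, div_lt_one hε] at h1
          rw [Metric.mem_ball, Real.dist_eq]
          exact h1
      · have hc : ContinuousAt (fun y => 2 - 4 * ((f y - f x) / ε) ^ 2) x := by fun_prop
        have : ∀ᶠ y in 𝓝 x, 1 < 2 - 4 * ((f y - f x) / ε) ^ 2 :=
          hc.eventually (lt_mem_nhds (by norm_num))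
        filter_upwards [this] with y hy
        exact Real.smoothTransition.one_of_one_le hy.le
    obtain ⟨ρ, h1, h2, h3, h4⟩ := hL (hC.isOpen_compl.mem_nhds hx)
    exact ⟨ρ, h1, h2, (Set.subset_compl_iff_disjoint_right.1 h3).inter_eq, h4⟩
  · intro H
    apply le_antisymm
    · exact le_iInf₂ fun f hf => continuous_iff_le_induced.1 (hcont f hf)
    · refine le_of_nhds_le_nhds fun x => ?_
      rw [key]
      intro U hU
      obtain ⟨ρ, h1, h2, h3, h4⟩ := H (interior U)ᶜ isOpen_interior.isClosed_compl x
        (by rw [compl_compl]; exact mem_interior_iff_mem_nhds.2 hU)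
      refine (iInf₂_le ρ h1 : _ ≤ Filter.comap ρ (𝓝 (ρ x))) ⟨Set.Ioi 0, Ioi_mem_nhds ?_, ?_⟩
      · rw [h4.self_of_nhds]
        exact one_pos
      · intro y hy
        by_contra hn
        have : y ∈ closure (Function.support ρ) ∩ (interior U)ᶜ :=
          ⟨subset_closure (ne_of_gt hy), fun h => hn (interior_subset h)⟩
        rw [h3] at this
        exact this
end

section
/- Let M be a topological space and 𝓕 a set of continuous functions M → ℝ such that for every f ∈ 𝓕 and every C^∞ function η : ℝ → ℝ, the composite η ∘ f belongs to 𝓕. If f ∈ 𝓕 and x₀ ∈ M satisfy f(x₀) ≠ 0, then there exist an open neighborhood V of x₀ and a function g ∈ 𝓕 such that f(y)·g(y) = 1 for all y ∈ V. -/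
/-- The key step of Lemma 2.58: in a family `𝓕` of continuous real-valued functions closed
under postcomposition with smooth functions `ℝ → ℝ`, any `f ∈ 𝓕` that is nonzero at a point
`x₀` admits a local multiplicative inverse from `𝓕` on a neighborhood of `x₀`. -/
theorem local_inverse_in_family {M : Type*} [TopologicalSpace M]
    (F : Set (M → ℝ))
    (hcont : ∀ f ∈ F, Continuous f)
    (hcomp : ∀ f ∈ F, ∀ η : ℝ → ℝ, ContDiff ℝ (⊤ : ℕ∞) η → (η ∘ f) ∈ F)
    (f : M → ℝ) (hf : f ∈ F) (x₀ : M) (hx : f x₀ ≠ 0) :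
    ∃ V : Set M, IsOpen V ∧ x₀ ∈ V ∧ ∃ g ∈ F, ∀ y ∈ V, f y * g y = 1 := by
  have hc : 0 < |f x₀| := abs_pos.mpr hx
  let b : ContDiffBump (f x₀) := ⟨|f x₀| / 4, |f x₀| / 2, by positivity, by linarith⟩
  have hne : ∀ t : ℝ, f x₀ + b t * (t - f x₀) ≠ 0 := by
    intro t h
    have h1 : |b t * (t - f x₀)| = |f x₀| := by
      rw [show b t * (t - f x₀) = -f x₀ by linarith, abs_neg]
    rw [abs_mul, abs_of_nonneg b.nonneg] at h1
    by_cases ht : |f x₀| / 2 ≤ dist t (f x₀)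
    · rw [b.zero_of_le_dist ht] at h1
      linarith
    · rw [Real.dist_eq] at ht
      have h2 : b t * |t - f x₀| ≤ 1 * |t - f x₀| :=
        mul_le_mul_of_nonneg_right b.le_one (abs_nonneg _)
      linarith
  have hsm : ContDiff ℝ (⊤ : ℕ∞) (fun t : ℝ => (f x₀ + b t * (t - f x₀))⁻¹) :=
    (contDiff_const.add (b.contDiff.mul (contDiff_id.sub contDiff_const))).inv hne
  refine ⟨f ⁻¹' Metric.ball (f x₀) (|f x₀| / 4), Metric.isOpen_ball.preimage (hcont f hf),
    Metric.mem_ball_self (by positivity), _, hcomp f hf _ hsm, ?_⟩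
  intro y hy
  have hb : b (f y) = 1 := b.one_of_mem_closedBall (Metric.ball_subset_closedBall hy)
  have h := hne (f y)
  simp only [Function.comp_apply]
  rw [hb] at h ⊢
  rw [show f x₀ + 1 * (f y - f x₀) = f y by ring] at h ⊢
  exact mul_inv_cancel₀ h
end
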